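/- Let A be a real symmetric N×N matrix, u a vector with all entries nonzero, and Ē ∈ ℝ, with v_i, K = K_Ē and ρ = ρ_{A,u,Ē} as in the definitions. Let D ⊆ [N] with K∖D nonempty, let 0 < α ≤ 1, and define G_{ii} := e^{α ρ(i, K∖D)} for i ∉ K∖D and G_{ii} := 0 for i ∈ K∖D. Then for all i, j ∉ K∖D with a_{ij} ≠ 0 and ρ(i,K∖D), ρ(j,K∖D) < ∞, one has (G_{ii} − G_{jj})² ≤ α² e^{α ρ(i,K∖D)} e^{α ρ(j,K∖D)} √(v_i v_j)/|a_{ij}|. Moreover, if i ∉ K∖D, j ∈ K∖D and a_{ij} ≠ 0 then ρ(i, K∖D) = 0 and (G_{ii} − G_{jj})² = 1. -/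

import Mathlib

open scoped ENNReal BigOperators
open Matrix

/-- The effective potential `(Au)_i / u_i`. -/
noncomputable def effV {N : ℕ} (A : Matrix (Fin N) (Fin N) ℝ) (u : Fin N → ℝ) (i : Fin N) : ℝ :=
  A.mulVec u i / u i

/-- The shifted effective potential `v_i = ((Au)_i/u_i - E)_+`. -/
noncomputable def shiftedV {N : ℕ} (A : Matrix (Fin N) (Fin N) ℝ) (u : Fin N → ℝ) (E : ℝ)
    (i : Fin N) : ℝ :=
  max (effV A u i - E) 0

/-- The weight of an edge `(i,j)`: `ln(1 + √(√(v_i v_j)/|a_ij|))`. -/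
noncomputable def edgeW {N : ℕ} (A : Matrix (Fin N) (Fin N) ℝ) (u : Fin N → ℝ) (E : ℝ)
    (i j : Fin N) : ℝ≥0∞ :=
  ENNReal.ofReal
    (Real.log (1 + Real.sqrt (Real.sqrt (shiftedV A u E i * shiftedV A u E j) / |A i j|)))

/-- The Agmon-type distance `ρ_{A,u,E}(i,j)`: infimum over paths `i = i_0, …, i_L = j` with
`a_{i_ℓ i_{ℓ+1}} ≠ 0` of the total edge weight; `∞` if there is no such path. -/
noncomputable def agmonDist {N : ℕ} (A : Matrix (Fin N) (Fin N) ℝ) (u : Fin N → ℝ) (E : ℝ)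
    (i j : Fin N) : ℝ≥0∞ :=
  ⨅ (L : ℕ) (p : Fin (L + 1) → Fin N) (_ : p 0 = i) (_ : p (Fin.last L) = j)
    (_ : ∀ ℓ : Fin L, A (p ℓ.castSucc) (p ℓ.succ) ≠ 0),
    ∑ ℓ : Fin L, edgeW A u E (p ℓ.castSucc) (p ℓ.succ)

/-- `ρ(i, M) = inf_{j ∈ M} ρ(i,j)` (`∞` when `M = ∅`). -/
noncomputable def agmonDistToSet {N : ℕ} (A : Matrix (Fin N) (Fin N) ℝ) (u : Fin N → ℝ) (E : ℝ)
    (i : Fin N) (M : Finset (Fin N)) : ℝ≥0∞ :=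
  ⨅ j ∈ M, agmonDist A u E i j

/-- The well set `K_E = {i : v_i = 0} = {i : (Au)_i/u_i ≤ E}`. -/
noncomputable def wellSet {N : ℕ} (A : Matrix (Fin N) (Fin N) ℝ) (u : Fin N → ℝ) (E : ℝ) :
    Finset (Fin N) :=
  Finset.univ.filter fun i => effV A u i ≤ E

/-- A `Z`-matrix: nonpositive off-diagonal entries. -/
def IsZMatrix {N : ℕ} (A : Matrix (Fin N) (Fin N) ℝ) : Prop :=
  ∀ i j, i ≠ j → A i j ≤ 0

/-- Connectivity at most `W`: every row and column has at most `W` nonzero off-diagonal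
entries. -/
def ConnAtMost {N : ℕ} (A : Matrix (Fin N) (Fin N) ℝ) (W : ℕ) : Prop :=
  ∀ i : Fin N, (Finset.univ.filter fun j => j ≠ i ∧ A i j ≠ 0).card ≤ W ∧
    (Finset.univ.filter fun j => j ≠ i ∧ A j i ≠ 0).card ≤ W

/-- `φ` is a local eigenvector of `A` on `M` with eigenvalue `E`: `φ ≠ 0`, `I_M φ = φ`, and
`I_M A I_M φ = E φ`. -/
def IsLocalEigenvector {N : ℕ} (A : Matrix (Fin N) (Fin N) ℝ) (M : Finset (Fin N)) (E : ℝ)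
    (φ : Fin N → ℝ) : Prop :=
  φ ≠ 0 ∧ (∀ i, i ∉ M → φ i = 0) ∧ (∀ i, i ∈ M → A.mulVec φ i = E * φ i)

/-- Extended exponential `e^x` for `x ∈ [0,∞]`. -/
noncomputable def eexp (x : ℝ≥0∞) : ℝ≥0∞ :=
  if x = ⊤ then ⊤ else ENNReal.ofReal (Real.exp x.toReal)

/-- Prepending an edge `(i,j)` to paths starting at `j`. -/
theorem agmonDist_le_edgeW_add {N : ℕ} (A : Matrix (Fin N) (Fin N) ℝ) (u : Fin N → ℝ) (E : ℝ)
    {i j : Fin N} (hij : A i j ≠ 0) (k : Fin N) :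
    agmonDist A u E i k ≤ edgeW A u E i j + agmonDist A u E j k := by
  conv_rhs => rw [agmonDist]
  simp only [ENNReal.add_iInf]
  refine le_iInf fun L => le_iInf fun p => le_iInf fun h0 => le_iInf fun hL => le_iInf fun hp => ?_
  refine iInf_le_of_le (L + 1) <| iInf_le_of_le (Fin.cons i p) <| iInf_le_of_le (by simp) <|
    iInf_le_of_le (by rw [← Fin.succ_last, Fin.cons_succ, hL]) <| iInf_le_of_le ?_ ?_
  · intro ℓ
    refine Fin.cases ?_ (fun m => ?_) ℓ
    · simpa [h0] using hij
    · simpa [← Fin.succ_castSucc] using hp m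
  · rw [Fin.sum_univ_succ]
    simp [h0]

theorem agmonDistToSet_le_edgeW_add {N : ℕ} (A : Matrix (Fin N) (Fin N) ℝ) (u : Fin N → ℝ)
    (E : ℝ) {i j : Fin N} (hij : A i j ≠ 0) (M : Finset (Fin N)) :
    agmonDistToSet A u E i M ≤ edgeW A u E i j + agmonDistToSet A u E j M := by
  conv_rhs => rw [agmonDistToSet]
  simp only [ENNReal.add_iInf]
  exact le_iInf fun k => le_iInf fun hk =>
    (iInf₂_le k hk).trans (agmonDist_le_edgeW_add A u E hij k)

theorem agmonDistToSet_eq_zero_of_mem {N : ℕ} (A : Matrix (Fin N) (Fin N) ℝ) (u : Fin N → ℝ)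
    (E : ℝ) {j : Fin N} {M : Finset (Fin N)} (hj : j ∈ M) : agmonDistToSet A u E j M = 0 := by
  refine le_antisymm ((iInf₂_le j hj).trans ?_) bot_le
  exact iInf_le_of_le 0 <| iInf_le_of_le (fun _ => j) <| iInf_le_of_le rfl <|
    iInf_le_of_le rfl <| iInf_le_of_le (fun ℓ => ℓ.elim0) (by simp)

theorem edgeW_comm {N : ℕ} {A : Matrix (Fin N) (Fin N) ℝ} (hA : A.IsSymm) (u : Fin N → ℝ)
    (E : ℝ) (i j : Fin N) : edgeW A u E i j = edgeW A u E j i := by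
  simp only [edgeW, mul_comm (shiftedV A u E i), hA.apply i j]

theorem edgeW_eq_zero_of_mem_wellSet {N : ℕ} (A : Matrix (Fin N) (Fin N) ℝ) (u : Fin N → ℝ)
    (E : ℝ) (i : Fin N) {j : Fin N} (hj : j ∈ wellSet A u E) : edgeW A u E i j = 0 := by
  have hv : shiftedV A u E j = 0 := by
    have : effV A u j ≤ E := by simpa [wellSet] using hj
    simpa [shiftedV] using this
  simp [edgeW, hv]

/-- Exponentials of real numbers at distance at most `log (1 + s)`. -/
theorem sq_exp_sub_exp_le {α s x y : ℝ} (hα0 : 0 ≤ α) (hα1 : α ≤ 1) (hs : 0 ≤ s)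
    (hxy : x ≤ Real.log (1 + s) + y) (hyx : y ≤ Real.log (1 + s) + x) :
    (Real.exp (α * x) - Real.exp (α * y)) ^ 2
      ≤ α ^ 2 * Real.exp (α * x) * Real.exp (α * y) * s ^ 2 := by
  wlog h : y ≤ x generalizing x y
  · have := this hyx hxy (le_of_not_ge h)
    linarith
  have hB : (1 + s) ^ α ≤ 1 + α * s := rpow_one_add_le_one_add_mul_self (by linarith) hα0 hα1
  have hle : Real.exp (α * x) ≤ Real.exp (α * y) * (1 + α * s) := by
    refine le_trans ?_ (mul_le_mul_of_nonneg_left hB (Real.exp_pos _).le)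
    rw [Real.rpow_def_of_pos (by linarith), ← Real.exp_add]
    exact Real.exp_le_exp.2 (by nlinarith)
  have hmono : Real.exp (α * y) ≤ Real.exp (α * x) := Real.exp_le_exp.2 (by gcongr)
  have hy := Real.exp_pos (α * y)
  calc (Real.exp (α * x) - Real.exp (α * y)) ^ 2
      ≤ (Real.exp (α * y) * (α * s)) ^ 2 :=
        pow_le_pow_left₀ (sub_nonneg.2 hmono) (by linarith) 2
    _ = (α * s) ^ 2 * (Real.exp (α * y) * Real.exp (α * y)) := by ring
    _ ≤ (α * s) ^ 2 * (Real.exp (α * x) * Real.exp (α * y)) := by gcongr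
    _ = _ := by ring

theorem toReal_agmonDistToSet_le {N : ℕ} (A : Matrix (Fin N) (Fin N) ℝ) (u : Fin N → ℝ)
    (E : ℝ) {i j : Fin N} (hij : A i j ≠ 0) (M : Finset (Fin N))
    (hj : agmonDistToSet A u E j M ≠ ⊤) :
    (agmonDistToSet A u E i M).toReal
      ≤ (edgeW A u E i j).toReal + (agmonDistToSet A u E j M).toReal := by
  have hw : edgeW A u E i j ≠ ⊤ := ENNReal.ofReal_ne_top
  rw [← ENNReal.toReal_add hw hj]
  exact ENNReal.toReal_mono (ENNReal.add_ne_top.2 ⟨hw, hj⟩)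
    (agmonDistToSet_le_edgeW_add A u E hij M)

/-- With `K∖D` nonempty, `0 < α ≤ 1`, and `G_{ii} = e^{αρ(i,K∖D)}` for
`i ∉ K∖D`, `G_{ii} = 0` for `i ∈ K∖D`: for `i, j ∉ K∖D` with `a_{ij} ≠ 0` and finite
distances, `(G_{ii}−G_{jj})² ≤ α² e^{αρ(i,K∖D)} e^{αρ(j,K∖D)} √(v_i v_j)/|a_{ij}|`;
and if `i ∉ K∖D`, `j ∈ K∖D`, `a_{ij} ≠ 0` then `ρ(i,K∖D) = 0` and `(G_{ii}−G_{jj})² = 1`. -/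
theorem G_difference_bounds {N : ℕ} (A : Matrix (Fin N) (Fin N) ℝ) (hA : A.IsSymm)
    (u : Fin N → ℝ) (hu : ∀ i, u i ≠ 0) (Ebar : ℝ) (D : Finset (Fin N))
    (hKD : (wellSet A u Ebar \ D).Nonempty) (α : ℝ) (hα0 : 0 < α) (hα1 : α ≤ 1) :
    let KD := wellSet A u Ebar \ D
    let G : Fin N → ℝ := fun k =>
      if k ∈ KD then 0 else Real.exp (α * (agmonDistToSet A u Ebar k KD).toReal)
    (∀ i j, i ∉ KD → j ∉ KD → A i j ≠ 0 →
        agmonDistToSet A u Ebar i KD ≠ ⊤ → agmonDistToSet A u Ebar j KD ≠ ⊤ →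
        (G i - G j) ^ 2
          ≤ α ^ 2 * Real.exp (α * (agmonDistToSet A u Ebar i KD).toReal) *
              Real.exp (α * (agmonDistToSet A u Ebar j KD).toReal) *
              (Real.sqrt (shiftedV A u Ebar i * shiftedV A u Ebar j) / |A i j|)) ∧
      (∀ i j, i ∉ KD → j ∈ KD → A i j ≠ 0 →
        agmonDistToSet A u Ebar i KD = 0 ∧ (G i - G j) ^ 2 = 1) := by
  intro KD G
  refine ⟨fun i j hi hj hij hfi hfj => ?_, fun i j hi hj hij => ?_⟩
  · set q := Real.sqrt (shiftedV A u Ebar i * shiftedV A u Ebar j) / |A i j|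
    have hq0 : 0 ≤ q := by positivity
    have hw : (edgeW A u Ebar i j).toReal = Real.log (1 + Real.sqrt q) :=
      ENNReal.toReal_ofReal (Real.log_nonneg (by linarith [Real.sqrt_nonneg q]))
    have h_ij := toReal_agmonDistToSet_le A u Ebar hij KD hfj
    have h_ji := toReal_agmonDistToSet_le A u Ebar (by rwa [hA.apply i j] : A j i ≠ 0) KD hfi
    rw [edgeW_comm hA] at h_ji
    rw [hw] at h_ij h_ji
    have key := sq_exp_sub_exp_le hα0.le hα1 (Real.sqrt_nonneg q) h_ij h_ji
    rw [Real.sq_sqrt hq0] at key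
    simpa only [G, if_neg hi, if_neg hj] using key
  · have h0 : agmonDistToSet A u Ebar i KD = 0 := by
      refine le_antisymm ((agmonDistToSet_le_edgeW_add A u Ebar hij KD).trans ?_) bot_le
      rw [edgeW_eq_zero_of_mem_wellSet A u Ebar i (Finset.mem_sdiff.1 hj).1,
        agmonDistToSet_eq_zero_of_mem A u Ebar hj, add_zero]
    exact ⟨h0, by simp [G, hi, hj, h0]⟩
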